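/- arXiv:0912.5501 — 5 statements merged into one kernel-verified Lean document; each statement's English description precedes it below -/
import Mathlib

section
/- If (X, Y) ∈ K × K satisfies Y² = X³ − 2aX² + rX and X ≠ 0, then the pair (x, y) = (Y²/(4X²), Y(r − X²)/(8X²)) satisfies y² = x³ + ax² + bx; that is, the map φ(X,Y) = (Y²/(4X²), Y(r − X²)/(8X²)) sends affine points of E' with nonzero X-coordinate to affine points of E. -/
/-- Let `K` be a field of characteristic ≠ 2, `a b : K` with `b ≠ 0` and `r = a² - 4b ≠ 0`.
If `(X, Y)` satisfies `Y² = X³ - 2aX² + rX` with `X ≠ 0`, then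
`(x, y) = (Y²/(4X²), Y(r - X²)/(8X²))` satisfies `y² = x³ + ax² + bx`. -/
theorem phi_maps_to_E {K : Type*} [Field K] (h2 : (2 : K) ≠ 0)
    (a b r : K) (hb : b ≠ 0) (hrdef : r = a ^ 2 - 4 * b) (hr : r ≠ 0)
    (X Y : K) (hXY : Y ^ 2 = X ^ 3 - 2 * a * X ^ 2 + r * X) (hX : X ≠ 0) :
    (Y * (r - X ^ 2) / (8 * X ^ 2)) ^ 2 =
      (Y ^ 2 / (4 * X ^ 2)) ^ 3 + a * (Y ^ 2 / (4 * X ^ 2)) ^ 2 +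
        b * (Y ^ 2 / (4 * X ^ 2)) := by
  have key : X ^ 2 * (r - X ^ 2) ^ 2 =
      (Y ^ 2) ^ 2 + 4 * a * X ^ 2 * Y ^ 2 + 16 * b * X ^ 4 := by
    rw [hXY, hrdef]
    ring
  have h4 : (4 : K) ≠ 0 := by
    rw [show (4 : K) = 2 ^ 2 by norm_num]
    exact pow_ne_zero 2 h2
  have h8 : (8 : K) ≠ 0 := by
    rw [show (8 : K) = 2 ^ 3 by norm_num]
    exact pow_ne_zero 3 h2
  have hx4 : 4 * X ^ 2 ≠ 0 := mul_ne_zero h4 (pow_ne_zero 2 hX)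
  have hx8 : 8 * X ^ 2 ≠ 0 := mul_ne_zero h8 (pow_ne_zero 2 hX)
  calc (Y * (r - X ^ 2) / (8 * X ^ 2)) ^ 2
      = Y ^ 2 * (X ^ 2 * (r - X ^ 2) ^ 2) / (4 * X ^ 2) ^ 3 := by
        rw [div_pow, div_eq_div_iff (pow_ne_zero 2 hx8) (pow_ne_zero 3 hx4)]
        ring
    _ = Y ^ 2 * ((Y ^ 2) ^ 2 + 4 * a * X ^ 2 * Y ^ 2 + 16 * b * X ^ 4) /
          (4 * X ^ 2) ^ 3 := by rw [key]
    _ = _ := by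
        rw [div_eq_iff (pow_ne_zero 3 hx4)]
        generalize hx : Y ^ 2 / (4 * X ^ 2) = x
        rw [div_eq_iff hx4] at hx
        rw [hx]
        ring
end

section
/- The curves E and E' have the same number of K-rational points: #E(K) = #E'(K). -/
open WeierstrassCurve

section CountingPoints

variable {K : Type*} [Field K]

/-- If `b` and `a ^ 2 - 4 * b` are nonzero, then `y ^ 2 = x ^ 3 + a * x ^ 2 + b * x` has one
rational point more than its affine part. -/
theorem card_point_eq_card_affine_add_one [Finite K] (h2 : (2 : K) ≠ 0) {a b : K} (hb : b ≠ 0)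
    (hr : a ^ 2 - 4 * b ≠ 0) :
    Nat.card (Affine.Point (R := K) { a₁ := 0, a₂ := a, a₃ := 0, a₄ := b, a₆ := 0 }) =
      Nat.card {p : K × K // p.2 ^ 2 = p.1 ^ 3 + a * p.1 ^ 2 + b * p.1} + 1 := by
  set W : WeierstrassCurve.Affine K := { a₁ := 0, a₂ := a, a₃ := 0, a₄ := b, a₆ := 0 } with hW
  have hΔ : W.Δ ≠ 0 := by
    have : W.Δ = 2 ^ 4 * b ^ 2 * (a ^ 2 - 4 * b) := by
      simp only [hW, WeierstrassCurve.Δ, WeierstrassCurve.b₂, WeierstrassCurve.b₄,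
        WeierstrassCurve.b₆, WeierstrassCurve.b₈]
      ring
    rw [this]
    exact mul_ne_zero (mul_ne_zero (pow_ne_zero _ h2) (pow_ne_zero _ hb)) hr
  rw [Nat.card_congr (Affine.nonsingularPointEquiv W), WithZero, Finite.card_option]
  congr 1
  refine Nat.card_congr (Equiv.subtypeEquivRight fun p ↦ ?_)
  rw [← Affine.equation_iff_nonsingular_of_Δ_ne_zero hΔ, Affine.equation_iff]
  simp [hW]

/-- The birational map `(x, y) ↦ (y / x, 2 * x + a - (y / x) ^ 2)` from a cubic with a rational
`2`-torsion point to a quartic misses only the point `(0, 0)`. -/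
theorem card_cubic_eq_card_quartic_add_one [Finite K] (h2 : (2 : K) ≠ 0) {a b : K} (hb : b ≠ 0) :
    Nat.card {p : K × K // p.2 ^ 2 = p.1 ^ 3 + a * p.1 ^ 2 + b * p.1} =
      Nat.card {p : K × K // p.2 ^ 2 = (p.1 ^ 2) ^ 2 - 2 * a * p.1 ^ 2 + (a ^ 2 - 4 * b)} + 1 := by
  classical
  have := Fintype.ofFinite K
  have root {t s : K} (h : s ^ 2 = (t ^ 2) ^ 2 - 2 * a * t ^ 2 + (a ^ 2 - 4 * b)) :
      ((s + t ^ 2 - a) / 2) ^ 2 - (t ^ 2 - a) * ((s + t ^ 2 - a) / 2) + b = 0 := by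
    field_simp
    linear_combination h
  simp only [Nat.card_eq_fintype_card, Fintype.card_subtype]
  rw [← Finset.card_erase_add_one (a := ((0, 0) : K × K)) (by simp)]
  congr 1
  refine Finset.card_nbij' (fun p ↦ (p.2 / p.1, 2 * p.1 + a - (p.2 / p.1) ^ 2))
    (fun p ↦ ((p.2 + p.1 ^ 2 - a) / 2, p.1 * ((p.2 + p.1 ^ 2 - a) / 2))) ?_ ?_ ?_ ?_
  all_goals
    rintro ⟨x, y⟩ h
    simp only [Finset.coe_erase, Finset.coe_filter, Finset.mem_univ, true_and, Set.mem_sdiff,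
      Set.mem_ofPred_eq, Set.mem_singleton_iff, Prod.mk.injEq] at h ⊢
  · have hx : x ≠ 0 := by
      rintro rfl
      simp_all
    obtain ⟨h, -⟩ := h
    field_simp
    linear_combination (-4 * x ^ 3) * h
  · have key := root h
    refine ⟨?_, fun h0 ↦ hb ?_⟩
    · linear_combination (-(y + x ^ 2 - a) / 2) * key
    · linear_combination key - ((y + x ^ 2 - a) / 2 - (x ^ 2 - a)) * h0.1
  · have hx : x ≠ 0 := by
      rintro rfl
      simp_all
    constructor <;> field_simp <;> ring
  · have hx : y + x ^ 2 - a ≠ 0 := fun hx ↦ hb <| by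
      linear_combination root h - ((y + x ^ 2 - a) / 2 - (x ^ 2 - a)) / 2 * hx
    constructor <;> field_simp
    ring

/-- The hyperbola `s ^ 2 = (u - a) ^ 2 - c` has one affine point for each unit of `K`. -/
theorem card_hyperbola_add_one [Finite K] (h2 : (2 : K) ≠ 0) {a c : K} (hc : c ≠ 0) :
    Nat.card {p : K × K // p.2 ^ 2 = (p.1 - a) ^ 2 - c} + 1 = Nat.card K := by
  classical
  have := Fintype.ofFinite K
  simp only [Nat.card_eq_fintype_card, Fintype.card_subtype]
  rw [← Finset.card_univ, ← Finset.card_erase_add_one (Finset.mem_univ (0 : K))]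
  congr 1
  refine Finset.card_nbij' (fun p ↦ p.1 - a + p.2)
    (fun t ↦ ((t + c / t) / 2 + a, (t - c / t) / 2)) ?_ ?_ ?_ ?_
  · rintro ⟨u, s⟩ h
    simp at h ⊢
    intro h0
    apply hc
    linear_combination h + (u - a - s) * h0
  · intro t ht
    simp at ht ⊢
    field_simp
    ring
  · rintro ⟨u, s⟩ h
    simp at h ⊢
    have h0 : u - a + s ≠ 0 := by
      intro h0
      apply hc
      linear_combination h + (u - a - s) * h0
    constructor <;> field_simp
    · linear_combination h
    · linear_combination -h
  · intro t ht
    simp at ht ⊢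
    field_simp
    ring

theorem ringChar_ne_two_of_two_ne_zero (h2 : (2 : K) ≠ 0) : ringChar K ≠ 2 := fun h ↦
  h2 <| by simpa [h] using ringChar.Nat.cast_ringChar (R := K)

variable [Fintype K] [DecidableEq K]

/-- The number of square roots of `c` is `χ c + 1`, as a filtered `Finset`. -/
theorem card_filter_sq_eq (h2 : (2 : K) ≠ 0) (c : K) :
    ((Finset.univ.filter fun y : K ↦ y ^ 2 = c).card : ℤ) = quadraticChar K c + 1 := by
  rw [← quadraticChar_card_sqrts (ringChar_ne_two_of_two_ne_zero h2) c]
  congr 2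
  ext
  simp

/-- The number of affine points of `y ^ 2 = f x` as a character sum. -/
theorem card_sq_eq_sum_quadraticChar (h2 : (2 : K) ≠ 0) (f : K → K) :
    (Nat.card {p : K × K // p.2 ^ 2 = f p.1} : ℤ) = ∑ x, (quadraticChar K (f x) + 1) := by
  rw [Nat.card_eq_fintype_card, Fintype.card_subtype, Finset.card_filter, Fintype.sum_prod_type]
  simp only [← card_filter_sq_eq h2, ← Finset.card_filter, Nat.cast_sum]

/-- Summing over squares weights each `u` by its number `χ u + 1` of square roots. -/
theorem sum_comp_sq (h2 : (2 : K) ≠ 0) (g : K → ℤ) :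
    ∑ t : K, g (t ^ 2) = ∑ u, (quadraticChar K u + 1) * g u := by
  rw [← Finset.sum_fiberwise' Finset.univ (fun t : K ↦ t ^ 2) g]
  simp only [← card_filter_sq_eq h2, Finset.sum_const, nsmul_eq_mul]

/-- The quartic `s ^ 2 = t ^ 4 - 2 * a * t ^ 2 + (a ^ 2 - 4 * b)` has one affine point fewer than
its quotient `Y ^ 2 = X * (X ^ 2 - 2 * a * X + (a ^ 2 - 4 * b))`. -/
theorem card_quartic_add_one_eq_card_cubic (h2 : (2 : K) ≠ 0) {a b : K} (hb : b ≠ 0) :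
    Nat.card {p : K × K // p.2 ^ 2 = (p.1 ^ 2) ^ 2 - 2 * a * p.1 ^ 2 + (a ^ 2 - 4 * b)} + 1 =
      Nat.card {p : K × K // p.2 ^ 2 = p.1 ^ 3 + -2 * a * p.1 ^ 2 + (a ^ 2 - 4 * b) * p.1} := by
  have hyp := card_hyperbola_add_one h2 (a := a) (c := 2 ^ 2 * b)
    (mul_ne_zero (pow_ne_zero _ h2) hb)
  zify at hyp ⊢
  rw [card_sq_eq_sum_quadraticChar h2 fun u ↦ (u - a) ^ 2 - 2 ^ 2 * b] at hyp
  rw [card_sq_eq_sum_quadraticChar h2 fun t ↦ (t ^ 2) ^ 2 - 2 * a * t ^ 2 + (a ^ 2 - 4 * b),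
    card_sq_eq_sum_quadraticChar h2 fun x ↦ x ^ 3 + -2 * a * x ^ 2 + (a ^ 2 - 4 * b) * x,
    sum_comp_sq h2 fun u ↦ quadraticChar K (u ^ 2 - 2 * a * u + (a ^ 2 - 4 * b)) + 1]
  have factor (x : K) : quadraticChar K (x ^ 3 + -2 * a * x ^ 2 + (a ^ 2 - 4 * b) * x) =
      quadraticChar K x * quadraticChar K (x ^ 2 - 2 * a * x + (a ^ 2 - 4 * b)) := by
    rw [← map_mul]
    ring_nf
  have shift (x : K) : (x - a) ^ 2 - 2 ^ 2 * b = x ^ 2 - 2 * a * x + (a ^ 2 - 4 * b) := by ring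
  have hχ : ∑ x : K, quadraticChar K x = 0 :=
    quadraticChar_sum_zero (ringChar_ne_two_of_two_ne_zero h2)
  simp only [factor, shift, add_mul, mul_add, Finset.sum_add_distrib, mul_one, one_mul, hχ,
    Finset.sum_const, Finset.card_univ, Nat.card_eq_fintype_card] at hyp ⊢
  simp at hyp ⊢
  linarith

end CountingPoints

/-- Let `K` be a finite field of characteristic ≠ 2, `a b : K` with `b ≠ 0` and
`r = a² - 4b ≠ 0`.  The curves `E : y² = x³ + ax² + bx` and `E' : Y² = X³ - 2aX² + rX`
have the same number of `K`-rational points. -/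
theorem card_points_eq {K : Type*} [Field K] [Fintype K] (h2 : (2 : K) ≠ 0)
    (a b r : K) (hb : b ≠ 0) (hrdef : r = a ^ 2 - 4 * b) (hr : r ≠ 0)
    (E E' : WeierstrassCurve.Affine K)
    (hE : E = { a₁ := 0, a₂ := a, a₃ := 0, a₄ := b, a₆ := 0 })
    (hE' : E' = { a₁ := 0, a₂ := -2 * a, a₃ := 0, a₄ := r, a₆ := 0 }) :
    Nat.card E.Point = Nat.card E'.Point := by
  classical
  subst hE hE' hrdef
  have hr' : (-2 * a) ^ 2 - 4 * (a ^ 2 - 4 * b) ≠ 0 := by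
    rw [show (-2 * a) ^ 2 - 4 * (a ^ 2 - 4 * b) = 2 ^ 4 * b by ring]
    exact mul_ne_zero (pow_ne_zero _ h2) hb
  rw [card_point_eq_card_affine_add_one h2 hb hr, card_point_eq_card_affine_add_one h2 hr hr',
    card_cubic_eq_card_quartic_add_one h2 hb, card_quartic_add_one_eq_card_cubic h2 hb]
end

section
/- Every affine point (x, y) ∈ E(K) whose x-coordinate is a nonzero square in K lies in the image of φ: there exists (X, Y) ∈ K × K with Y² = X³ − 2aX² + rX, X ≠ 0, Y²/(4X²) = x and Y(r − X²)/(8X²) = y. -/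
/-- Let `K` be a finite field of characteristic ≠ 2, `a b : K` with `b ≠ 0` and
`r = a² - 4b ≠ 0`.  Every affine point `(x, y)` on `E : y² = x³ + ax² + bx` whose
`x`-coordinate is a nonzero square lies in the image of
`φ(X, Y) = (Y²/(4X²), Y(r - X²)/(8X²))`. -/
theorem square_x_in_image {K : Type*} [Field K] [Fintype K] (h2 : (2 : K) ≠ 0)
    (a b r : K) (hb : b ≠ 0) (hrdef : r = a ^ 2 - 4 * b) (hr : r ≠ 0)
    (x y : K) (hxy : y ^ 2 = x ^ 3 + a * x ^ 2 + b * x)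
    (hx : x ≠ 0) (hsq : IsSquare x) :
    ∃ X Y : K, Y ^ 2 = X ^ 3 - 2 * a * X ^ 2 + r * X ∧ X ≠ 0 ∧
      Y ^ 2 / (4 * X ^ 2) = x ∧ Y * (r - X ^ 2) / (8 * X ^ 2) = y := by
  obtain ⟨w, rfl⟩ := hsq
  have hw : w ≠ 0 := left_ne_zero_of_mul hx
  obtain ⟨t, rfl⟩ : ∃ t, y = w * t := ⟨y / w, by field_simp⟩
  have ht : t ^ 2 = w ^ 4 + a * w ^ 2 + b :=
    mul_left_cancel₀ hx (by linear_combination hxy)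
  have hprod : (2 * w ^ 2 + a - 2 * t) * (2 * w ^ 2 + a + 2 * t) = r := by
    linear_combination -4 * ht - hrdef
  obtain ⟨X, hX⟩ : ∃ X, X = 2 * w ^ 2 + a - 2 * t := ⟨_, rfl⟩
  rw [← hX] at hprod
  have hX0 : X ≠ 0 := left_ne_zero_of_mul (hprod.trans_ne hr)
  have h4 : (4 : K) ≠ 0 := by
    convert mul_ne_zero h2 h2 using 1
    norm_num
  have h8 : (8 : K) ≠ 0 := by
    convert mul_ne_zero h2 h4 using 1
    norm_num
  refine ⟨X, 2 * w * X, ?_, hX0, ?_, ?_⟩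
  · linear_combination -X ^ 2 * hX + X * hprod
  · rw [div_eq_iff (mul_ne_zero h4 (pow_ne_zero 2 hX0))]
    ring
  · rw [div_eq_iff (mul_ne_zero h8 (pow_ne_zero 2 hX0))]
    linear_combination -2 * w * X * hprod - 2 * w * X ^ 2 * hX
end

section
/- Suppose (X, Y) ∈ K × K satisfies Y² = X³ − 2aX² + rX, X ≠ 0, and Y²/(4X²) = x for some x ∈ K. Then X² − 2(a + 2x)X + r = 0; in particular X = a + 2x + s or X = a + 2x − s for some s ∈ K with s² = 4(x² + ax + b). -/
/-- Let `K` be a field of characteristic ≠ 2, `a b : K` with `b ≠ 0` and `r = a² - 4b ≠ 0`.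
If `(X, Y)` satisfies `Y² = X³ - 2aX² + rX`, `X ≠ 0`, and `Y²/(4X²) = x`, then
`X² - 2(a + 2x)X + r = 0`; in particular `X = a + 2x + s` or `X = a + 2x - s` for some
`s : K` with `s² = 4(x² + ax + b)`. -/
theorem preimage_X_quadratic {K : Type*} [Field K] (h2 : (2 : K) ≠ 0)
    (a b r : K) (hb : b ≠ 0) (hrdef : r = a ^ 2 - 4 * b) (hr : r ≠ 0)
    (X Y x : K) (hXY : Y ^ 2 = X ^ 3 - 2 * a * X ^ 2 + r * X) (hX : X ≠ 0)
    (hx : Y ^ 2 / (4 * X ^ 2) = x) :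
    X ^ 2 - 2 * (a + 2 * x) * X + r = 0 ∧
      ∃ s : K, s ^ 2 = 4 * (x ^ 2 + a * x + b) ∧
        (X = a + 2 * x + s ∨ X = a + 2 * x - s) := by
  have h4 : (4 : K) * X ^ 2 ≠ 0 := by
    rw [show (4 : K) = 2 ^ 2 by norm_num]
    exact mul_ne_zero (pow_ne_zero 2 h2) (pow_ne_zero 2 hX)
  have hquad : X ^ 2 - 2 * (a + 2 * x) * X + r = 0 := by
    rw [div_eq_iff h4] at hx
    apply mul_left_cancel₀ hX
    linear_combination hx - hXY
  refine ⟨hquad, X - (a + 2 * x), ?_, Or.inl (by ring)⟩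
  linear_combination hquad - hrdef
end

section
/- If (x, 0) ∈ E(K) is a 2-torsion point with x a nonzero square in K (so that x² + ax + b = 0), then setting X = a + 2x one has X² = r, Y² = 4X²x admits a solution Y ∈ K, and φ(X, Y) = (x, 0); in particular (x,0) lies in the image of φ. -/
/-- Let `K` be a finite field of characteristic ≠ 2, `a b : K` with `b ≠ 0` and
`r = a² - 4b ≠ 0`.  If `(x, 0)` is a 2-torsion point of `E : y² = x³ + ax² + bx` with `x`
a nonzero square (so `x² + ax + b = 0`), then for `X = a + 2x` one has `X² = r`, there is
`Y : K` with `Y² = 4X²x`, and `φ(X, Y) = (x, 0)`; in particular `(x, 0)` lies in the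
image of `φ`. -/
theorem two_torsion_in_image {K : Type*} [Field K] [Fintype K] (h2 : (2 : K) ≠ 0)
    (a b r : K) (hb : b ≠ 0) (hrdef : r = a ^ 2 - 4 * b) (hr : r ≠ 0)
    (x : K) (hx : x ≠ 0) (hsq : IsSquare x) (hroot : x ^ 2 + a * x + b = 0) :
    (a + 2 * x) ^ 2 = r ∧ a + 2 * x ≠ 0 ∧
      ∃ Y : K, Y ^ 2 = 4 * (a + 2 * x) ^ 2 * x ∧
        Y ^ 2 = (a + 2 * x) ^ 3 - 2 * a * (a + 2 * x) ^ 2 + r * (a + 2 * x) ∧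
        Y ^ 2 / (4 * (a + 2 * x) ^ 2) = x ∧
        Y * (r - (a + 2 * x) ^ 2) / (8 * (a + 2 * x) ^ 2) = 0 := by
  have hX : (a + 2 * x) ^ 2 = r := by linear_combination 4 * hroot - hrdef
  have hX0 : a + 2 * x ≠ 0 := fun h => hr (by rw [← hX, h, zero_pow two_ne_zero])
  have h4 : (4 : K) * (a + 2 * x) ^ 2 ≠ 0 := by
    rw [show (4 : K) = 2 ^ 2 by norm_num]
    exact mul_ne_zero (pow_ne_zero 2 h2) (pow_ne_zero 2 hX0)
  obtain ⟨s, hs⟩ := hsq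
  have hY : (2 * (a + 2 * x) * s) ^ 2 = 4 * (a + 2 * x) ^ 2 * x := by
    linear_combination -4 * (a + 2 * x) ^ 2 * hs
  refine ⟨hX, hX0, 2 * (a + 2 * x) * s, hY, ?_, ?_, ?_⟩
  · linear_combination hY + (a + 2 * x) * hX
  · rw [hY, mul_div_cancel_left₀ x h4]
  · rw [hX, sub_self, mul_zero, zero_div]
end
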